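/- For all x ∈ ℝ and all μ ∈ ℝ, one has ∫_{−∞}^x ((u−μ)/σ²)·f_μ(u) du = −f_μ(x) − Σ_{i=1}^k [h(b_i)·G_μ(x,b_i) − h(a_i)·G_μ(x,a_i)]. -/

import Mathlib

open MeasureTheory ProbabilityTheory Set Filter Topology

noncomputable def stdphi (x : ℝ) : ℝ := Real.exp (-(x ^ 2) / 2) / Real.sqrt (2 * Real.pi)

noncomputable def stdPhi (x : ℝ) : ℝ := ∫ t in Iic x, stdphi t

noncomputable def stdPhiInv : ℝ → ℝ := Function.invFun stdPhi

noncomputable def stdPhiE (c : EReal) (x s : ℝ) : ℝ :=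
  if c = ⊤ then 1 else if c = ⊥ then 0 else stdPhi ((c.toReal - x) / s)

def truncOrdered {k : ℕ} (a b : Fin k → EReal) : Prop :=
  (∀ i, a i < b i) ∧ ∀ i j : Fin k, i < j → b i < a j

def truncSet {k : ℕ} (a b : Fin k → EReal) : Set ℝ :=
  {x : ℝ | ∃ i, a i < (x : EReal) ∧ (x : EReal) < b i}

noncomputable def truncSum {k : ℕ} (a b : Fin k → EReal) (s x : ℝ) : ℝ :=
  ∑ i, (stdPhiE (b i) x s - stdPhiE (a i) x s)

noncomputable def condPDF {k : ℕ} (a b : Fin k → EReal) (σ τ μ x : ℝ) : ℝ :=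
  (1 / σ) * stdphi ((x - μ) / σ) * truncSum a b τ x
    / truncSum a b (Real.sqrt (σ ^ 2 + τ ^ 2)) μ

noncomputable def Fmu {k : ℕ} (a b : Fin k → EReal) (σ τ μ x : ℝ) : ℝ :=
  ∫ u in Iic x, condPDF a b σ τ μ u

/-- `G_μ(x,v) = Φ((x - (ρ²μ + (1-ρ²)v))/(σρ))` with `ρ² = τ²/(σ²+τ²)`. -/
noncomputable def Gfun (σ τ μ x v : ℝ) : ℝ :=
  stdPhi ((x - (τ ^ 2 / (σ ^ 2 + τ ^ 2) * μ + (1 - τ ^ 2 / (σ ^ 2 + τ ^ 2)) * v)) /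
    (σ * Real.sqrt (τ ^ 2 / (σ ^ 2 + τ ^ 2))))

/-- `G_μ(x,v)` for an extended-real `v`, with the natural conventions at `±∞`. -/
noncomputable def GfunE (σ τ μ x : ℝ) (c : EReal) : ℝ :=
  if c = ⊤ then 0 else if c = ⊥ then 1 else Gfun σ τ μ x c.toReal

/-- `h(v)` from Lemma `le_dmu_formula`. -/
noncomputable def hfun {k : ℕ} (a b : Fin k → EReal) (σ τ μ v : ℝ) : ℝ :=
  (1 / Real.sqrt (σ ^ 2 + τ ^ 2)) * stdphi ((v - μ) / Real.sqrt (σ ^ 2 + τ ^ 2)) /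
    truncSum a b (Real.sqrt (σ ^ 2 + τ ^ 2)) μ

/-- `h(v)` for an extended-real `v`, with the convention `φ(±∞) = 0`. -/
noncomputable def hfunE {k : ℕ} (a b : Fin k → EReal) (σ τ μ : ℝ) (c : EReal) : ℝ :=
  if c = ⊤ then 0 else if c = ⊥ then 0 else hfun a b σ τ μ c.toReal

/-- `l(x,v)` from Lemma `le_dens_dx`. -/
noncomputable def lfun {k : ℕ} (a b : Fin k → EReal) (τ x v : ℝ) : ℝ :=
  (1 / τ) * stdphi ((v - x) / τ) / truncSum a b τ x

/-- `l(x,v)` for an extended-real `v`, with the convention `φ(±∞) = 0`. -/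
noncomputable def lfunE {k : ℕ} (a b : Fin k → EReal) (τ x : ℝ) (c : EReal) : ℝ :=
  if c = ⊤ then 0 else if c = ⊥ then 0 else lfun a b τ x c.toReal

/-- The function `B_μ(x)` from the proof of Proposition 1. -/
noncomputable def Bfun {k : ℕ} (a b : Fin k → EReal) (σ τ μ x : ℝ) : ℝ :=
  Real.sqrt (τ ^ 2 / (σ ^ 2 + τ ^ 2)) / σ * stdphi (stdPhiInv (Fmu a b σ τ μ x))
    - condPDF a b σ τ μ x
    + ∑ i, (hfunE a b σ τ μ (b i) * (Fmu a b σ τ μ x - GfunE σ τ μ x (b i))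
        - hfunE a b σ τ μ (a i) * (Fmu a b σ τ μ x - GfunE σ τ μ x (a i)))

theorem hasDerivAt_stdphi (x : ℝ) : HasDerivAt stdphi (-x * stdphi x) x := by
  have h : HasDerivAt (fun y : ℝ => -(y ^ 2) / 2) (-x) x := by
    refine ((hasDerivAt_pow 2 x).fun_neg.div_const 2).congr_deriv ?_
    norm_num
    ring
  refine (h.exp.div_const (Real.sqrt (2 * Real.pi))).congr_deriv ?_
  simp only [stdphi]
  ring

theorem continuous_stdphi : Continuous stdphi :=
  continuous_iff_continuousAt.2 fun x => (hasDerivAt_stdphi x).continuousAt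

theorem stdphi_nonneg (x : ℝ) : 0 ≤ stdphi x := by
  unfold stdphi
  positivity

theorem integrable_stdphi : Integrable stdphi := by
  have h := (integrable_exp_neg_mul_sq (b := 1 / 2) (by norm_num)).div_const
    (Real.sqrt (2 * Real.pi))
  refine h.congr (Eventually.of_forall fun x => ?_)
  simp only [stdphi]
  ring_nf

theorem integrable_mul_stdphi : Integrable fun x => x * stdphi x := by
  have h := (integrable_mul_exp_neg_mul_sq (b := 1 / 2) (by norm_num)).div_const
    (Real.sqrt (2 * Real.pi))
  refine h.congr (Eventually.of_forall fun x => ?_)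
  simp only [stdphi]
  ring_nf

theorem tendsto_stdphi_atBot : Tendsto stdphi atBot (𝓝 0) := by
  have hsq : Tendsto (fun x : ℝ => x ^ 2) atBot atTop :=
    ((tendsto_pow_atTop two_ne_zero).comp tendsto_abs_atBot_atTop).congr fun x => sq_abs x
  have h : Tendsto (fun x : ℝ => -(x ^ 2) / 2) atBot atBot :=
    (tendsto_neg_atTop_atBot.comp hsq).atBot_div_const two_pos
  have h2 := (Real.tendsto_exp_atBot.comp h).div_const (Real.sqrt (2 * Real.pi))
  rw [zero_div] at h2
  exact h2

theorem hasDerivAt_stdPhi (x : ℝ) : HasDerivAt stdPhi (stdphi x) x := by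
  have h : stdPhi = fun y => stdPhi 0 + ∫ t in (0 : ℝ)..y, stdphi t := by
    funext y
    have := intervalIntegral.integral_Iic_sub_Iic (a := 0) (b := y)
      integrable_stdphi.integrableOn integrable_stdphi.integrableOn
    simp only [stdPhi]
    linarith
  rw [h]
  exact (continuous_stdphi.integral_hasStrictDerivAt 0 x).hasDerivAt.const_add _

theorem continuous_stdPhi : Continuous stdPhi :=
  continuous_iff_continuousAt.2 fun x => (hasDerivAt_stdPhi x).continuousAt

theorem abs_stdPhi_le (x : ℝ) : |stdPhi x| ≤ ∫ t, stdphi t := by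
  rw [stdPhi, abs_of_nonneg (setIntegral_nonneg measurableSet_Iic fun t _ => stdphi_nonneg t)]
  exact setIntegral_le_integral integrable_stdphi (Eventually.of_forall stdphi_nonneg)

theorem tendsto_stdPhi_atBot : Tendsto stdPhi atBot (𝓝 0) := by
  have h := intervalIntegral_tendsto_integral_Iic (0 : ℝ)
    integrable_stdphi.integrableOn tendsto_id
  have h2 := (tendsto_const_nhds (x := stdPhi 0)).sub h
  rw [show (∫ x in Iic (0 : ℝ), stdphi x) = stdPhi 0 from rfl, sub_self] at h2
  refine h2.congr fun y => ?_
  have := intervalIntegral.integral_Iic_sub_Iic (a := y) (b := 0)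
    integrable_stdphi.integrableOn integrable_stdphi.integrableOn
  simp only [stdPhi, id]
  linarith

theorem tendsto_sub_div_atBot (m : ℝ) {s : ℝ} (hs : 0 < s) :
    Tendsto (fun x : ℝ => (x - m) / s) atBot atBot :=
  (tendsto_atBot_add_const_right atBot (-m) tendsto_id).atBot_div_const hs

theorem hasDerivAt_sub_div (m s x : ℝ) : HasDerivAt (fun x : ℝ => (x - m) / s) (1 / s) x :=
  ((hasDerivAt_id x).sub_const m).div_const s

/-- A product of two Gaussian densities factors into the marginal and the conditional one. -/
theorem stdphi_mul_stdphi {σ τ : ℝ} (hσ : 0 < σ) (hτ : 0 < τ) (μ u v : ℝ) :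
    (1 / σ) * stdphi ((u - μ) / σ) * ((1 / τ) * stdphi ((v - u) / τ)) =
      (1 / Real.sqrt (σ ^ 2 + τ ^ 2)) * stdphi ((v - μ) / Real.sqrt (σ ^ 2 + τ ^ 2)) *
        (1 / (σ * Real.sqrt (τ ^ 2 / (σ ^ 2 + τ ^ 2))) *
          stdphi ((u - (τ ^ 2 / (σ ^ 2 + τ ^ 2) * μ + (1 - τ ^ 2 / (σ ^ 2 + τ ^ 2)) * v)) /
            (σ * Real.sqrt (τ ^ 2 / (σ ^ 2 + τ ^ 2))))) := by
  have hS : 0 < Real.sqrt (σ ^ 2 + τ ^ 2) := by positivity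
  have hS2 : Real.sqrt (σ ^ 2 + τ ^ 2) ^ 2 = σ ^ 2 + τ ^ 2 := Real.sq_sqrt (by positivity)
  have hR : Real.sqrt (τ ^ 2 / (σ ^ 2 + τ ^ 2)) = τ / Real.sqrt (σ ^ 2 + τ ^ 2) := by
    rw [Real.sqrt_div (by positivity), Real.sqrt_sq hτ.le]
  rw [hR]
  have hexp : Real.exp (-(((u - μ) / σ) ^ 2) / 2) * Real.exp (-(((v - u) / τ) ^ 2) / 2) =
      Real.exp (-(((v - μ) / Real.sqrt (σ ^ 2 + τ ^ 2)) ^ 2) / 2) *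
        Real.exp (-(((u - (τ ^ 2 / (σ ^ 2 + τ ^ 2) * μ + (1 - τ ^ 2 / (σ ^ 2 + τ ^ 2)) * v)) /
          (σ * (τ / Real.sqrt (σ ^ 2 + τ ^ 2)))) ^ 2) / 2) := by
    rw [← Real.exp_add, ← Real.exp_add]
    congr 1
    simp only [div_pow, mul_pow, hS2]
    field_simp
    ring
  have hc : 1 / σ * (1 / τ) = 1 / Real.sqrt (σ ^ 2 + τ ^ 2) *
      (1 / (σ * (τ / Real.sqrt (σ ^ 2 + τ ^ 2)))) := by
    field_simp
  unfold stdphi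
  calc
    _ = (1 / σ * (1 / τ)) * (Real.exp (-(((u - μ) / σ) ^ 2) / 2) *
          Real.exp (-(((v - u) / τ) ^ 2) / 2)) / Real.sqrt (2 * Real.pi) ^ 2 := by ring
    _ = _ := by
      rw [hexp, hc]
      ring

/-- The derivative of `c ↦ Φ((c - x)/τ)` in `x`, with the conventions at `±∞`. -/
noncomputable def stdphiE (c : EReal) (x s : ℝ) : ℝ :=
  if c = ⊤ then 0 else if c = ⊥ then 0 else (1 / s) * stdphi ((c.toReal - x) / s)

theorem hasDerivAt_stdPhiE (c : EReal) (x s : ℝ) :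
    HasDerivAt (fun x => stdPhiE c x s) (-stdphiE c x s) x := by
  unfold stdPhiE stdphiE
  split_ifs
  · simpa using hasDerivAt_const x (1 : ℝ)
  · simpa using hasDerivAt_const x (0 : ℝ)
  · have h : HasDerivAt (fun x : ℝ => (c.toReal - x) / s) (-1 / s) x :=
      ((hasDerivAt_id x).const_sub _).div_const s
    exact ((hasDerivAt_stdPhi _).comp x h).congr_deriv (by ring)

theorem exists_abs_stdPhiE_le (c : EReal) (s : ℝ) : ∃ C, ∀ x, |stdPhiE c x s| ≤ C := by
  unfold stdPhiE
  split_ifs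
  · exact ⟨1, by simp⟩
  · exact ⟨0, by simp⟩
  · exact ⟨_, fun x => abs_stdPhi_le _⟩

/-- `h(v)` without its normalising constant, extended by `0` to `±∞`. -/
noncomputable def unnormalizedHfunE (σ τ μ : ℝ) (c : EReal) : ℝ :=
  if c = ⊤ then 0 else if c = ⊥ then 0 else
    (1 / Real.sqrt (σ ^ 2 + τ ^ 2)) * stdphi ((c.toReal - μ) / Real.sqrt (σ ^ 2 + τ ^ 2))

theorem hfunE_eq_div {k : ℕ} (a b : Fin k → EReal) (σ τ μ : ℝ) (c : EReal) :
    hfunE a b σ τ μ c =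
      unnormalizedHfunE σ τ μ c / truncSum a b (Real.sqrt (σ ^ 2 + τ ^ 2)) μ := by
  unfold hfunE unnormalizedHfunE hfun
  split_ifs <;> simp

theorem hasDerivAt_unnormalizedHfunE_mul_GfunE {σ τ : ℝ} (hσ : 0 < σ) (hτ : 0 < τ) (μ x : ℝ)
    (c : EReal) :
    HasDerivAt (fun x => unnormalizedHfunE σ τ μ c * GfunE σ τ μ x c)
      ((1 / σ) * stdphi ((x - μ) / σ) * stdphiE c x τ) x := by
  unfold unnormalizedHfunE GfunE stdphiE
  split_ifs
  · simpa using hasDerivAt_const x (0 : ℝ)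
  · simpa using hasDerivAt_const x (0 : ℝ)
  · rw [stdphi_mul_stdphi hσ hτ]
    refine (((hasDerivAt_stdPhi _).comp x (hasDerivAt_sub_div
      (τ ^ 2 / (σ ^ 2 + τ ^ 2) * μ + (1 - τ ^ 2 / (σ ^ 2 + τ ^ 2)) * c.toReal)
      (σ * Real.sqrt (τ ^ 2 / (σ ^ 2 + τ ^ 2))) x)).const_mul _).congr_deriv ?_
    ring

theorem tendsto_unnormalizedHfunE_mul_GfunE_atBot {σ τ : ℝ} (hσ : 0 < σ) (hτ : 0 < τ) (μ : ℝ)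
    (c : EReal) :
    Tendsto (fun x => unnormalizedHfunE σ τ μ c * GfunE σ τ μ x c) atBot (𝓝 0) := by
  unfold unnormalizedHfunE GfunE
  split_ifs
  · simp
  · simp
  · have h := (tendsto_stdPhi_atBot.comp (tendsto_sub_div_atBot
      (τ ^ 2 / (σ ^ 2 + τ ^ 2) * μ + (1 - τ ^ 2 / (σ ^ 2 + τ ^ 2)) * c.toReal)
      (s := σ * Real.sqrt (τ ^ 2 / (σ ^ 2 + τ ^ 2))) (by positivity))).const_mul
      ((1 / Real.sqrt (σ ^ 2 + τ ^ 2)) * stdphi ((c.toReal - μ) / Real.sqrt (σ ^ 2 + τ ^ 2)))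
    rw [mul_zero] at h
    exact h

theorem integrable_mul_stdphi_mul_stdPhiE {σ : ℝ} (hσ : 0 < σ) (τ μ : ℝ) (c : EReal) :
    Integrable fun u => (u - μ) / σ ^ 2 * ((1 / σ) * stdphi ((u - μ) / σ) * stdPhiE c u τ) := by
  obtain ⟨C, hC⟩ := exists_abs_stdPhiE_le c τ
  have h1 : Integrable fun u => (u - μ) / σ * stdphi ((u - μ) / σ) :=
    (integrable_mul_stdphi.comp_div hσ.ne').comp_sub_right μ
  have hcont : Continuous fun u => stdPhiE c u τ :=
    continuous_iff_continuousAt.2 fun u => (hasDerivAt_stdPhiE c u τ).continuousAt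
  have h2 := (h1.mul_bdd (c := C) hcont.aestronglyMeasurable
    (Eventually.of_forall hC)).const_mul (1 / σ ^ 2)
  refine h2.congr (Eventually.of_forall fun u => ?_)
  field_simp

theorem setIntegral_Iic_mul_stdphi_mul_stdPhiE {σ τ : ℝ} (hσ : 0 < σ) (hτ : 0 < τ) (μ x : ℝ)
    (c : EReal) :
    ∫ u in Iic x, (u - μ) / σ ^ 2 * ((1 / σ) * stdphi ((u - μ) / σ) * stdPhiE c u τ) =
      -((1 / σ) * stdphi ((x - μ) / σ) * stdPhiE c x τ)
        - unnormalizedHfunE σ τ μ c * GfunE σ τ μ x c := by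
  have hderiv : ∀ u, HasDerivAt (fun u => -((1 / σ) * stdphi ((u - μ) / σ) * stdPhiE c u τ)
        - unnormalizedHfunE σ τ μ c * GfunE σ τ μ u c)
      ((u - μ) / σ ^ 2 * ((1 / σ) * stdphi ((u - μ) / σ) * stdPhiE c u τ)) u := by
    intro u
    have h := (((((hasDerivAt_stdphi _).comp u (hasDerivAt_sub_div μ σ u)).const_mul (1 / σ)).mul
      (hasDerivAt_stdPhiE c u τ)).neg).sub (hasDerivAt_unnormalizedHfunE_mul_GfunE hσ hτ μ u c)
    refine h.congr_deriv ?_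
    simp only [Function.comp_apply]
    field_simp
    ring
  have hlim : Tendsto (fun u => -((1 / σ) * stdphi ((u - μ) / σ) * stdPhiE c u τ)
      - unnormalizedHfunE σ τ μ c * GfunE σ τ μ u c) atBot (𝓝 0) := by
    obtain ⟨C, hC⟩ := exists_abs_stdPhiE_le c τ
    have h1 := (tendsto_stdphi_atBot.comp (tendsto_sub_div_atBot μ hσ)).const_mul (1 / σ)
    rw [mul_zero] at h1
    have h2 := h1.zero_mul_isBoundedUnder_le
      (isBoundedUnder_of ⟨C, hC⟩ : IsBoundedUnder (· ≤ ·) atBot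
        (norm ∘ fun u => stdPhiE c u τ))
    simpa using h2.neg.sub (tendsto_unnormalizedHfunE_mul_GfunE_atBot hσ hτ μ c)
  rw [integral_Iic_of_hasDerivAt_of_tendsto' (fun u _ => hderiv u)
    (integrable_mul_stdphi_mul_stdPhiE hσ τ μ c).integrableOn hlim, sub_zero]

/-- Lemma (`le_int_f1`): `∫_{-∞}^x ((u-μ)/σ²) f_μ(u) du
  = -f_μ(x) - ∑ᵢ (h(bᵢ) G_μ(x,bᵢ) - h(aᵢ) G_μ(x,aᵢ))`. -/
theorem stmt16 {k : ℕ} (a b : Fin (k + 1) → EReal) (hab : truncOrdered a b)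
    (σ τ : ℝ) (hσ : 0 < σ) (hτ : 0 < τ) (x μ : ℝ) :
    ∫ u in Iic x, (u - μ) / σ ^ 2 * condPDF a b σ τ μ u
      = -condPDF a b σ τ μ x
        - ∑ i, (hfunE a b σ τ μ (b i) * GfunE σ τ μ x (b i)
            - hfunE a b σ τ μ (a i) * GfunE σ τ μ x (a i)) := by
  set Z := truncSum a b (Real.sqrt (σ ^ 2 + τ ^ 2)) μ with hZ
  have hint := fun c => (integrable_mul_stdphi_mul_stdPhiE hσ τ μ c).integrableOn (s := Iic x)
  have hdecomp : ∀ u, (u - μ) / σ ^ 2 * condPDF a b σ τ μ u =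
      (∑ i, ((u - μ) / σ ^ 2 * ((1 / σ) * stdphi ((u - μ) / σ) * stdPhiE (b i) u τ)
        - (u - μ) / σ ^ 2 * ((1 / σ) * stdphi ((u - μ) / σ) * stdPhiE (a i) u τ))) / Z := by
    intro u
    simp only [condPDF, ← hZ, truncSum.eq_1 a b τ, ← mul_sub, ← Finset.mul_sum]
    ring
  simp only [hdecomp]
  rw [integral_div, integral_finsetSum _ fun i _ => (hint (b i)).fun_sub (hint (a i))]
  simp only [integral_sub (hint _) (hint _), setIntegral_Iic_mul_stdphi_mul_stdPhiE hσ hτ,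
    hfunE_eq_div, ← hZ, condPDF, truncSum.eq_1 a b τ]
  simp only [Finset.sum_sub_distrib, Finset.mul_sum, Finset.sum_div, div_mul_eq_mul_div,
    Finset.sum_neg_distrib, mul_sub, sub_div, neg_div]
  ring
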